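/- arXiv:2507.04544 — 2 statements merged into one kernel-verified Lean document; each statement's English description precedes it below -/
import Mathlib

section
/- Let Q(z) = ∑_{s=0}^n q_s z^s be a polynomial of degree n with Q(1) ≠ 0, and let γ_k denote the Taylor coefficients at 0 of Q(z)√(1−z), so Q(z)√(1−z) = ∑_{k=0}^∞ γ_k z^k. Define the polynomial P(x) = ∑_{s=0}^n q_s · x^(s̲) · (x − s − 3/2)^((n−s)̲), where x^(m̲) = x(x−1)⋯(x−m+1) is the falling factorial. Then for every k ≥ 0, γ_k · (k − 3/2)^(n̲) = c_k · P(k), and P has degree n with leading coefficient Q(1). -/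
open Finset

/-- The falling factorial `x^(m̲) = x(x-1)⋯(x-m+1)` for a complex argument. -/
def fallC (x : ℂ) (m : ℕ) : ℂ := ∏ i ∈ Finset.range m, (x - i)

/-- `c_k = (-1)^k * binom(1/2, k)`, the `k`-th Taylor coefficient at `0` of the
principal branch of `√(1-z)`. -/
noncomputable def sqrtOneSubCoeff (k : ℕ) : ℝ :=
  (-1) ^ k * ((∏ i ∈ Finset.range k, ((1 : ℝ) / 2 - i)) / (k.factorial : ℝ))

theorem fallC_succ_left (x : ℂ) (m : ℕ) : fallC x (m + 1) = x * fallC (x - 1) m := by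
  simp only [fallC, Finset.prod_range_succ', Nat.cast_add, Nat.cast_one, Nat.cast_zero, sub_zero]
  rw [mul_comm]
  congr 1
  exact Finset.prod_congr rfl fun i _ => by ring

theorem fallC_add (x : ℂ) (s m : ℕ) : fallC x (s + m) = fallC x s * fallC (x - s) m := by
  simp only [fallC, Finset.prod_range_add, Nat.cast_add, sub_add_eq_sub_sub]

theorem fallC_natCast_eq_zero {k s : ℕ} (h : k < s) : fallC k s = 0 :=
  Finset.prod_eq_zero (Finset.mem_range.mpr h) (sub_self _)

theorem eval_descPochhammer_eq_fallC (x : ℂ) (m : ℕ) :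
    (descPochhammer ℂ m).eval x = fallC x m := by
  induction m with
  | zero => simp [fallC]
  | succ m ih => rw [descPochhammer_succ_eval, ih, fallC, fallC, Finset.prod_range_succ]

theorem sqrtOneSubCoeff_succ (k : ℕ) :
    sqrtOneSubCoeff (k + 1) * (k + 1) = sqrtOneSubCoeff k * (k - 1 / 2) := by
  have : (k.factorial : ℝ) ≠ 0 := by positivity
  have : (k : ℝ) + 1 ≠ 0 := by positivity
  simp only [sqrtOneSubCoeff, Finset.prod_range_succ, Nat.factorial_succ]
  push_cast
  field_simp
  ring

theorem sqrtOneSubCoeff_mul_fallC (j s : ℕ) :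
    (sqrtOneSubCoeff j : ℂ) * fallC (((j + s : ℕ) : ℂ) - 3 / 2) s =
      (sqrtOneSubCoeff (j + s) : ℂ) * fallC ((j + s : ℕ) : ℂ) s := by
  induction s with
  | zero => simp [fallC]
  | succ s ih =>
    have h : (sqrtOneSubCoeff (j + s + 1) : ℂ) * ((j + s : ℕ) + 1) =
        sqrtOneSubCoeff (j + s) * ((j + s : ℕ) - 1 / 2) := by
      simpa using congrArg Complex.ofReal (sqrtOneSubCoeff_succ (j + s))
    rw [← add_assoc, fallC_succ_left, fallC_succ_left, Nat.cast_succ,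
      show ((j + s : ℕ) : ℂ) + 1 - 3 / 2 - 1 = (j + s : ℕ) - 3 / 2 by ring, add_sub_cancel_right]
    linear_combination
      (((j + s : ℕ) : ℂ) - 1 / 2) * ih - fallC ((j + s : ℕ) : ℂ) s * h

theorem sqrtOneSubCoeff_eq_choose (k : ℕ) :
    (sqrtOneSubCoeff k : ℂ) = (-1) ^ k * Ring.choose (1 / 2 : ℂ) k := by
  rw [Ring.choose_eq_smul, Polynomial.descPochhammer_smeval_eq_ascPochhammer,
    Polynomial.ascPochhammer_smeval_cast, Polynomial.ascPochhammer_smeval_eq_eval,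
    ← descPochhammer_eval_eq_ascPochhammer, eval_descPochhammer_eq_fallC]
  simp only [sqrtOneSubCoeff, fallC, smul_eq_mul]
  push_cast
  ring

theorem eventually_hasSum_sqrtOneSubCoeff :
    ∀ᶠ z : ℂ in nhds 0,
      HasSum (fun k : ℕ => (sqrtOneSubCoeff k : ℂ) * z ^ k) ((1 - z) ^ ((1 : ℂ) / 2)) := by
  have h := hasFPowerSeriesAt_iff.mp
    (Complex.one_add_cpow_hasFPowerSeriesAt_zero (a := (1 : ℂ) / 2))
  have hneg : Filter.Tendsto (fun z : ℂ => -z) (nhds 0) (nhds 0) := by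
    simpa using (continuous_neg (G := ℂ)).tendsto 0
  filter_upwards [hneg.eventually h] with z hz
  convert! hz using 1
  · funext k
    rw [sqrtOneSubCoeff_eq_choose, binomialSeries, FormalMultilinearSeries.coeff_ofScalars,
      neg_pow, smul_eq_mul]
    ring
  · rw [zero_add, sub_eq_add_neg]

theorem HasSum.shift_mul_pow {a : ℕ → ℂ} {z S : ℂ} (h : HasSum (fun k => a k * z ^ k) S) (s : ℕ) :
    HasSum (fun k => (if s ≤ k then a (k - s) else 0) * z ^ k) (z ^ s * S) := by
  rw [← (add_left_injective s).hasSum_iff]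
  · convert! h.mul_left (z ^ s) using 1
    funext k
    simp only [Function.comp_apply, Nat.le_add_left, if_true, Nat.add_sub_cancel, pow_add]
    ring
  · intro k hk
    rw [if_neg, zero_mul]
    exact fun hsk => hk ⟨k - s, Nat.sub_add_cancel hsk⟩

theorem coeff_eq_of_eventually_hasSum {a b : ℕ → ℂ} {f : ℂ → ℂ}
    (ha : ∀ᶠ z in nhds 0, HasSum (fun k => a k * z ^ k) (f z))
    (hb : ∀ᶠ z in nhds 0, HasSum (fun k => b k * z ^ k) (f z)) : a = b := by
  have key {c : ℕ → ℂ} (hc : ∀ᶠ z in nhds 0, HasSum (fun k => c k * z ^ k) (f z)) :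
      HasFPowerSeriesAt f (FormalMultilinearSeries.ofScalars ℂ c) 0 := by
    rw [hasFPowerSeriesAt_iff]
    simpa only [FormalMultilinearSeries.coeff_ofScalars, smul_eq_mul, mul_comm, zero_add] using hc
  have h := (key ha).eq_formalMultilinearSeries (key hb)
  funext k
  simpa only [FormalMultilinearSeries.coeff_ofScalars] using
    congrArg (fun p => FormalMultilinearSeries.coeff p k) h

theorem coeff_polynomial_mul_sqrt {n : ℕ} {q γ : ℕ → ℂ}
    (hγ : ∀ᶠ z : ℂ in nhds 0,
      HasSum (fun k : ℕ => γ k * z ^ k)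
        ((∑ s ∈ Finset.range (n + 1), q s * z ^ s) * (1 - z) ^ ((1 : ℂ) / 2))) (k : ℕ) :
    γ k = ∑ s ∈ Finset.range (n + 1),
      q s * (if s ≤ k then (sqrtOneSubCoeff (k - s) : ℂ) else 0) := by
  refine congrFun (coeff_eq_of_eventually_hasSum hγ (b := fun k => ∑ s ∈ Finset.range (n + 1),
      q s * (if s ≤ k then (sqrtOneSubCoeff (k - s) : ℂ) else 0)) ?_) k
  filter_upwards [eventually_hasSum_sqrtOneSubCoeff] with z hz
  convert! hasSum_sum (s := Finset.range (n + 1))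
    fun s _ => (hz.shift_mul_pow s).mul_left (q s) using 1
  · funext k
    simp only [Finset.sum_mul, mul_assoc]
  · simp only [Finset.sum_mul, mul_assoc]

theorem shifted_coeff_mul_fallC {n s : ℕ} (hs : s ≤ n) (k : ℕ) :
    (if s ≤ k then (sqrtOneSubCoeff (k - s) : ℂ) else 0) * fallC ((k : ℂ) - 3 / 2) n =
      sqrtOneSubCoeff k * (fallC k s * fallC ((k : ℂ) - s - 3 / 2) (n - s)) := by
  split_ifs with h
  · obtain ⟨j, rfl⟩ := Nat.exists_eq_add_of_le' h
    have hsplit := fallC_add (((j + s : ℕ) : ℂ) - 3 / 2) s (n - s)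
    rw [Nat.add_sub_cancel' hs, sub_right_comm] at hsplit
    rw [Nat.add_sub_cancel, hsplit, ← mul_assoc, sqrtOneSubCoeff_mul_fallC, mul_assoc]
  · rw [fallC_natCast_eq_zero (not_le.mp h)]
    ring

open Polynomial in
theorem monic_descPochhammer_mul_comp (s m : ℕ) (a : ℂ) :
    (descPochhammer ℂ s * (descPochhammer ℂ m).comp (X - C a)).Monic ∧
      (descPochhammer ℂ s * (descPochhammer ℂ m).comp (X - C a)).natDegree = s + m := by
  have hs := monic_descPochhammer ℂ s
  have hm := (monic_descPochhammer ℂ m).comp_X_sub_C a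
  refine ⟨hs.mul hm, ?_⟩
  rw [hs.natDegree_mul hm, natDegree_comp, natDegree_X_sub_C, mul_one,
    descPochhammer_natDegree, descPochhammer_natDegree]

open Polynomial in
theorem degree_leadingCoeff_sum_C_mul_monic {n : ℕ} {q : ℕ → ℂ} {p : ℕ → ℂ[X]}
    (hp : ∀ s ∈ Finset.range (n + 1), (p s).Monic ∧ (p s).natDegree = n)
    (hq : ∑ s ∈ Finset.range (n + 1), q s ≠ 0) :
    (∑ s ∈ Finset.range (n + 1), C (q s) * p s).degree = n ∧
      (∑ s ∈ Finset.range (n + 1), C (q s) * p s).leadingCoeff =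
        ∑ s ∈ Finset.range (n + 1), q s := by
  have hcoeff : (∑ s ∈ Finset.range (n + 1), C (q s) * p s).coeff n =
      ∑ s ∈ Finset.range (n + 1), q s := by
    rw [finsetSum_coeff]
    refine Finset.sum_congr rfl fun s hs => ?_
    obtain ⟨hmonic, hdeg⟩ := hp s hs
    rw [coeff_C_mul, ← hdeg, hmonic.coeff_natDegree, mul_one]
  have hle : (∑ s ∈ Finset.range (n + 1), C (q s) * p s).natDegree ≤ n :=
    natDegree_sum_le_of_forall_le _ _ fun s hs =>
      (natDegree_C_mul_le _ _).trans (hp s hs).2.le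
  have hdeg := natDegree_eq_of_le_of_coeff_ne_zero hle (hcoeff ▸ hq)
  refine ⟨?_, by rw [leadingCoeff, hdeg, hcoeff]⟩
  rw [degree_eq_natDegree, hdeg]
  intro h
  rw [h, coeff_zero] at hcoeff
  exact hq hcoeff.symm

/-- Let `Q(z) = ∑_{s=0}^n q_s z^s` be a polynomial of degree `n`
with `Q(1) ≠ 0`, and let `γ_k` be the Taylor coefficients at `0` of `Q(z)√(1-z)`.
With `P(x) = ∑_{s=0}^n q_s · x^(s̲) · (x-s-3/2)^((n-s)̲)`, we have
`γ_k · (k-3/2)^(n̲) = c_k · P(k)` for every `k ≥ 0`, and `P` is a polynomial of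
degree `n` with leading coefficient `Q(1)`. -/
theorem product_coefficients
    (n : ℕ) (q : ℕ → ℂ)
    (hdeg : q n ≠ 0)
    (hQ1 : (∑ s ∈ Finset.range (n + 1), q s) ≠ 0)
    (γ : ℕ → ℂ)
    (hγ : ∀ᶠ z : ℂ in nhds 0,
      HasSum (fun k : ℕ => γ k * z ^ k)
        ((∑ s ∈ Finset.range (n + 1), q s * z ^ s) * (1 - z) ^ ((1 : ℂ) / 2))) :
    (∀ k : ℕ, γ k * fallC ((k : ℂ) - 3 / 2) n =
        (sqrtOneSubCoeff k : ℂ) *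
          (∑ s ∈ Finset.range (n + 1),
            q s * fallC (k : ℂ) s * fallC ((k : ℂ) - s - 3 / 2) (n - s))) ∧
    ∃ p : Polynomial ℂ,
      (∀ x : ℂ, p.eval x =
        ∑ s ∈ Finset.range (n + 1), q s * fallC x s * fallC (x - s - 3 / 2) (n - s)) ∧
      p.degree = n ∧ p.leadingCoeff = ∑ s ∈ Finset.range (n + 1), q s := by
  refine ⟨fun k => ?_, ?_⟩
  · rw [coeff_polynomial_mul_sqrt hγ, Finset.sum_mul, Finset.mul_sum]
    refine Finset.sum_congr rfl fun s hs => ?_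
    rw [mul_assoc, shifted_coeff_mul_fallC (Finset.mem_range_succ_iff.mp hs)]
    ring
  · refine ⟨∑ s ∈ Finset.range (n + 1), Polynomial.C (q s) * (descPochhammer ℂ s *
      (descPochhammer ℂ (n - s)).comp (Polynomial.X - Polynomial.C ((s : ℂ) + 3 / 2))),
      fun x => ?_, degree_leadingCoeff_sum_C_mul_monic (fun s hs => ?_) hQ1⟩
    · simp only [Polynomial.eval_finsetSum, Polynomial.eval_mul, Polynomial.eval_C,
        Polynomial.eval_comp, Polynomial.eval_sub, Polynomial.eval_X,
        eval_descPochhammer_eq_fallC, sub_add_eq_sub_sub, mul_assoc]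
    · have h := monic_descPochhammer_mul_comp s (n - s) ((s : ℂ) + 3 / 2)
      rwa [Nat.add_sub_cancel' (Finset.mem_range_succ_iff.mp hs)] at h
end

section
/- Fix n ≥ 0 and let γ_k denote the Taylor coefficients at 0 of T_n(z)√(1−z). Then γ_0 = 1, the series ∑_{k=0}^∞ γ_k converges absolutely with ∑_{k=0}^∞ γ_k = 0, and ∑_{k=1}^∞ |γ_k| = 1. -/
open Finset

open PowerSeries in
/-- The power series `F` converges to `f` on a neighbourhood of `0` in `ℂ`. -/
def ConvergesNearZero (F : PowerSeries ℝ) (f : ℂ → ℂ) : Prop :=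
  ∀ᶠ z : ℂ in nhds 0, HasSum (fun k : ℕ => ((coeff k F : ℝ) : ℂ) * z ^ k) (f z)

namespace ConvergesNearZero

open PowerSeries

variable {F G : PowerSeries ℝ} {f g : ℂ → ℂ}

theorem hasFPowerSeriesAt (hF : ConvergesNearZero F f) :
    HasFPowerSeriesAt f
      (FormalMultilinearSeries.ofScalars ℂ fun k : ℕ => ((coeff k F : ℝ) : ℂ)) 0 := by
  rw [hasFPowerSeriesAt_iff]
  filter_upwards [hF] with z hz
  simpa [FormalMultilinearSeries.coeff_ofScalars, mul_comm] using hz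

theorem unique (hF : ConvergesNearZero F f) (hG : ConvergesNearZero G f) : F = G := by
  have h := hF.hasFPowerSeriesAt.eq_formalMultilinearSeries hG.hasFPowerSeriesAt
  ext k
  have hk := congrArg (fun p => FormalMultilinearSeries.coeff p k) h
  simpa [FormalMultilinearSeries.coeff_ofScalars] using hk

theorem congr (hF : ConvergesNearZero F f) (h : ∀ z, f z = g z) : ConvergesNearZero F g :=
  (funext h : f = g) ▸ hF

theorem mul (hF : ConvergesNearZero F f) (hG : ConvergesNearZero G g) :
    ConvergesNearZero (F * G) (fun z => f z * g z) := by
  filter_upwards [hF, hG] with z hf hg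
  have hf' := hf.summable.norm
  have hg' := hg.summable.norm
  have hs := (summable_norm_sum_mul_antidiagonal_of_summable_norm hf' hg').of_norm.hasSum
  rw [← tsum_mul_tsum_eq_tsum_sum_antidiagonal_of_summable_norm hf' hg', hf.tsum_eq,
    hg.tsum_eq] at hs
  refine (congrArg (HasSum · (f z * g z)) (funext fun k => ?_)).mpr hs
  rw [coeff_mul]
  push_cast
  rw [Finset.sum_mul]
  refine Finset.sum_congr rfl fun p hp => ?_
  rw [← Finset.HasAntidiagonal.mem_antidiagonal.mp hp, pow_add]
  ring

theorem polynomial (p : Polynomial ℝ) :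
    ConvergesNearZero (p : PowerSeries ℝ) (fun z => Polynomial.aeval z p) := by
  refine Filter.Eventually.of_forall fun z => ?_
  simp only [Polynomial.aeval_eq_sum_range, Polynomial.coeff_coe, Complex.real_smul]
  refine hasSum_sum_of_ne_finset_zero fun k hk => ?_
  rw [Polynomial.coeff_eq_zero_of_natDegree_lt (by simpa using hk)]
  simp

theorem coeff_zero (hF : ConvergesNearZero F f) : ((coeff 0 F : ℝ) : ℂ) = f 0 := by
  refine HasSum.unique ?_ hF.self_of_nhds
  convert hasSum_ite_eq 0 ((coeff 0 F : ℝ) : ℂ) using 2 with k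
  rcases eq_or_ne k 0 with rfl | hk <;> simp [*]

end ConvergesNearZero

theorem PowerSeries.eq_of_sq_eq_sq_of_coeff_zero {F G : PowerSeries ℝ} (h : F ^ 2 = G ^ 2)
    (hF : coeff 0 F = 1) (hG : coeff 0 G = 1) : F = G := by
  rcases sq_eq_sq_iff_eq_or_eq_neg.mp h with h | h
  · exact h
  · rw [h, map_neg, hG] at hF
    norm_num at hF

/-- The Taylor coefficients of `1 / √(1 - z)`. -/
noncomputable def invSqrtCoeff (k : ℕ) : ℝ := (Nat.centralBinom k : ℝ) / 4 ^ k

theorem invSqrtCoeff_zero : invSqrtCoeff 0 = 1 := by simp [invSqrtCoeff]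

theorem invSqrtCoeff_pos (k : ℕ) : 0 < invSqrtCoeff k := by
  have := Nat.centralBinom_pos k
  unfold invSqrtCoeff
  positivity

theorem invSqrtCoeff_succ (k : ℕ) :
    invSqrtCoeff (k + 1) = (2 * k + 1) / (2 * k + 2) * invSqrtCoeff k := by
  have h : ((k : ℝ) + 1) * (Nat.centralBinom (k + 1) : ℝ)
      = 2 * (2 * k + 1) * Nat.centralBinom k := by
    exact_mod_cast Nat.succ_mul_centralBinom_succ k
  unfold invSqrtCoeff
  rw [pow_succ]
  field_simp
  linear_combination 2 * h

theorem sq_invSqrtCoeff_mul_le (k : ℕ) : invSqrtCoeff k ^ 2 * (2 * k + 1) ≤ 1 := by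
  induction k with
  | zero => simp [invSqrtCoeff_zero]
  | succ k ih =>
    refine le_trans ?_ ih
    rw [invSqrtCoeff_succ, mul_pow, mul_comm (_ ^ 2), mul_assoc]
    refine mul_le_mul_of_nonneg_left ?_ (sq_nonneg _)
    push_cast
    rw [div_pow, div_mul_eq_mul_div, div_le_iff₀ (by positivity)]
    have : (0 : ℝ) ≤ k := k.cast_nonneg
    nlinarith

theorem tendsto_invSqrtCoeff : Filter.Tendsto invSqrtCoeff Filter.atTop (nhds 0) := by
  have h : Filter.Tendsto (fun k => invSqrtCoeff k ^ 2) Filter.atTop (nhds 0) := by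
    refine squeeze_zero (fun k => sq_nonneg _) (fun k => ?_)
      (tendsto_one_div_add_atTop_nhds_zero_nat (𝕜 := ℝ))
    rw [le_div_iff₀ (by positivity)]
    refine le_trans (mul_le_mul_of_nonneg_left ?_ (sq_nonneg _)) (sq_invSqrtCoeff_mul_le k)
    have : (0 : ℝ) ≤ k := k.cast_nonneg
    linarith
  have h' := h.sqrt
  simpa [Real.sqrt_sq (invSqrtCoeff_pos _).le] using h'

open PowerSeries

/-- The power series of `1 / √(1 - z)`. -/
noncomputable def invSqrtSeries : PowerSeries ℝ := mk invSqrtCoeff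

theorem constantCoeff_invSqrtSeries : constantCoeff invSqrtSeries = 1 := by
  rw [← coeff_zero_eq_constantCoeff_apply, invSqrtSeries, coeff_mk, invSqrtCoeff_zero]

/-- The power series of `√(1 - z)`. -/
noncomputable def sqrtSeries : PowerSeries ℝ := (1 - X) * invSqrtSeries

theorem one_sub_X_mul_derivative_invSqrtSeries :
    2 * ((1 - X) * derivative ℝ invSqrtSeries) = invSqrtSeries := by
  ext k
  rw [← map_ofNat (C (R := ℝ)) 2, coeff_C_mul, sub_mul, one_mul, map_sub]
  cases k with
  | zero =>
    simp [invSqrtSeries, coeff_derivative, invSqrtCoeff_succ, invSqrtCoeff_zero,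
      -coeff_zero_eq_constantCoeff, coeff_zero_X_mul]
  | succ k =>
    rw [coeff_succ_X_mul, coeff_derivative, coeff_derivative]
    simp only [invSqrtSeries, coeff_mk]
    rw [invSqrtCoeff_succ (k + 1)]
    push_cast
    field_simp
    ring

theorem one_sub_X_mul_invSqrtSeries_sq : (1 - X) * invSqrtSeries ^ 2 = 1 := by
  refine derivative.ext ?_ ?_
  · have h := one_sub_X_mul_derivative_invSqrtSeries
    simp only [Derivation.leibniz, Derivation.leibniz_pow, map_sub, derivative_one, derivative_X,
      smul_eq_mul, nsmul_eq_mul]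
    push_cast
    linear_combination invSqrtSeries * h
  · simp [constantCoeff_invSqrtSeries]

theorem sqrtSeries_mul_invSqrtSeries : sqrtSeries * invSqrtSeries = 1 := by
  rw [← one_sub_X_mul_invSqrtSeries_sq, sqrtSeries]
  ring

theorem sqrtSeries_sq : sqrtSeries ^ 2 = 1 - X := by
  have h := one_sub_X_mul_invSqrtSeries_sq
  rw [sqrtSeries]
  linear_combination (1 - X) * h

theorem coeff_zero_sqrtSeries : coeff 0 sqrtSeries = 1 := by
  simp [sqrtSeries, constantCoeff_invSqrtSeries]

theorem coeff_succ_sqrtSeries (k : ℕ) :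
    coeff (k + 1) sqrtSeries = -(invSqrtCoeff k / (2 * k + 2)) := by
  rw [sqrtSeries, sub_mul, one_mul, map_sub, coeff_succ_X_mul]
  simp only [invSqrtSeries, coeff_mk]
  rw [invSqrtCoeff_succ]
  field_simp
  ring

theorem coeff_succ_sqrtSeries_neg (k : ℕ) : coeff (k + 1) sqrtSeries < 0 := by
  rw [coeff_succ_sqrtSeries, neg_lt_zero]
  have := invSqrtCoeff_pos k
  positivity

theorem coeff_add_two_sqrtSeries (k : ℕ) :
    coeff (k + 2) sqrtSeries = (2 * k + 1) / (2 * k + 4) * coeff (k + 1) sqrtSeries := by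
  rw [coeff_succ_sqrtSeries (k + 1), coeff_succ_sqrtSeries, invSqrtCoeff_succ]
  push_cast
  field_simp
  ring

theorem monotone_invSqrtCoeff_three_mul_add_div {r : ℕ} (hr : 1 ≤ r) :
    Monotone fun j => invSqrtCoeff (3 * j + r) / invSqrtCoeff j := by
  refine monotone_nat_of_le_succ fun j => ?_
  obtain ⟨s, rfl⟩ := Nat.exists_eq_add_of_le hr
  have hj := invSqrtCoeff_pos j
  have hm := invSqrtCoeff_pos (3 * j + (1 + s))
  rw [show 3 * (j + 1) + (1 + s) = 3 * j + (1 + s) + 1 + 1 + 1 by ring]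
  simp only [invSqrtCoeff_succ]
  push_cast
  rw [div_le_div_iff₀ hj (by positivity)]
  generalize invSqrtCoeff (3 * j + (1 + s)) = x at *
  generalize invSqrtCoeff j = y at *
  have key : (2 * (j : ℝ) + 1) / (2 * j + 2) ≤
      (2 * (3 * (j : ℝ) + (1 + s) + 1 + 1) + 1) / (2 * (3 * (j : ℝ) + (1 + s) + 1 + 1) + 2) *
      ((2 * (3 * (j : ℝ) + (1 + s) + 1) + 1) / (2 * (3 * (j : ℝ) + (1 + s) + 1) + 2) *
      ((2 * (3 * (j : ℝ) + (1 + s)) + 1) / (2 * (3 * (j : ℝ) + (1 + s)) + 2))) := by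
    rw [div_mul_div_comm, div_mul_div_comm, div_le_div_iff₀ (by positivity) (by positivity),
      ← sub_nonneg]
    ring_nf
    positivity
  calc _ = (2 * (j : ℝ) + 1) / (2 * j + 2) * (x * y) := by ring
    _ ≤ _ := mul_le_mul_of_nonneg_right key (by positivity)
    _ = _ := by ring

theorem sum_coeff_sqrtSeries_mul_invSqrtCoeff_nonneg (L : ℕ) {r : ℕ} (hr : 1 ≤ r) :
    0 ≤ ∑ i ∈ Finset.range (L + 1), coeff i sqrtSeries * invSqrtCoeff (3 * (L - i) + r) := by
  set u : ℕ → ℝ := fun j => invSqrtCoeff (3 * j + r) / invSqrtCoeff j with hu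
  have hmono : Monotone u := monotone_invSqrtCoeff_three_mul_add_div hr
  have hconv : 0 ≤ ∑ i ∈ Finset.range (L + 1), coeff i sqrtSeries * invSqrtCoeff (L - i) := by
    have h := congrArg (coeff L) sqrtSeries_mul_invSqrtSeries
    rw [coeff_mul, Finset.Nat.sum_antidiagonal_eq_sum_range_succ_mk, coeff_one] at h
    simp only [invSqrtSeries, coeff_mk] at h
    rw [h]
    split_ifs <;> norm_num
  have hu0 : 0 ≤ u L := (div_pos (invSqrtCoeff_pos _) (invSqrtCoeff_pos _)).le
  refine le_trans (mul_nonneg hconv hu0) ?_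
  rw [Finset.sum_mul]
  refine Finset.sum_le_sum fun i _ => ?_
  have hd := invSqrtCoeff_pos (L - i)
  have hval : invSqrtCoeff (3 * (L - i) + r) = invSqrtCoeff (L - i) * u (L - i) := by
    simp only [hu]
    field_simp
  rw [hval, ← mul_assoc]
  cases i with
  | zero => simp
  | succ i =>
    exact mul_le_mul_of_nonpos_left (hmono (Nat.sub_le _ _))
      (mul_nonpos_of_nonpos_of_nonneg (coeff_succ_sqrtSeries_neg i).le hd.le)

/-- The power series of `√(1 - z³)`. -/
noncomputable def sqrtCubeSeries : PowerSeries ℝ := expand 3 three_ne_zero sqrtSeries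

theorem sqrtCubeSeries_sq : sqrtCubeSeries ^ 2 = 1 - X ^ 3 := by
  rw [sqrtCubeSeries, ← map_pow, sqrtSeries_sq, map_sub, map_one, expand_X]

theorem coeff_zero_sqrtCubeSeries : coeff 0 sqrtCubeSeries = 1 := by
  rw [sqrtCubeSeries, coeff_expand]
  simpa using coeff_zero_sqrtSeries

theorem coeff_sqrtCubeSeries_nonpos {k : ℕ} (hk : k ≠ 0) : coeff k sqrtCubeSeries ≤ 0 := by
  rw [sqrtCubeSeries, coeff_expand]
  split_ifs with h
  · obtain ⟨m, rfl⟩ := h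
    obtain ⟨m, rfl⟩ := Nat.exists_eq_succ_of_ne_zero (n := m) (by rintro rfl; simp at hk)
    rw [Nat.mul_div_cancel_left _ (by norm_num)]
    exact (coeff_succ_sqrtSeries_neg m).le
  · exact le_rfl

theorem Finset.sum_range_three_mul_add_of_not_dvd (h : ℕ → ℝ) (hh : ∀ i, ¬ 3 ∣ i → h i = 0)
    (L : ℕ) {r : ℕ} (hr : 1 ≤ r) (hr3 : r ≤ 3) :
    ∑ i ∈ Finset.range (3 * L + r), h i = ∑ i ∈ Finset.range (L + 1), h (3 * i) := by
  have h1 : ∀ L, h (3 * L + 1) = 0 := fun L => hh _ (by omega)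
  have h2 : ∀ L, h (3 * L + 1 + 1) = 0 := fun L => hh _ (by omega)
  have base : ∑ i ∈ Finset.range (3 * L + 1), h i = ∑ i ∈ Finset.range (L + 1), h (3 * i) := by
    induction L with
    | zero => simp
    | succ L ih =>
      rw [Finset.sum_range_succ _ (L + 1), ← ih, Finset.sum_range_succ,
        show 3 * (L + 1) = 3 * L + 1 + 1 + 1 by ring, Finset.sum_range_succ _ (3 * L + 1 + 1),
        Finset.sum_range_succ _ (3 * L + 1), h1, h2]
      ring
  obtain rfl | rfl | rfl : r = 1 ∨ r = 2 ∨ r = 3 := by omega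
  · exact base
  · rw [← base, Finset.sum_range_succ _ (3 * L + 1), h1, add_zero]
  · rw [← base, Finset.sum_range_succ _ (3 * L + 2), Finset.sum_range_succ _ (3 * L + 1), h1, h2,
      add_zero, add_zero]

/-- The power series of `√(1 + z + z²)`. -/
noncomputable def sqrtQuadSeries : PowerSeries ℝ := sqrtCubeSeries * invSqrtSeries

theorem sqrtQuadSeries_sq : sqrtQuadSeries ^ 2 = 1 + X + X ^ 2 := by
  rw [sqrtQuadSeries, mul_pow, sqrtCubeSeries_sq]
  linear_combination (1 + X + X ^ 2) * one_sub_X_mul_invSqrtSeries_sq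

theorem coeff_zero_sqrtQuadSeries : coeff 0 sqrtQuadSeries = 1 := by
  have h := coeff_zero_sqrtCubeSeries
  rw [sqrtQuadSeries]
  simp_all [constantCoeff_invSqrtSeries]

theorem sqrtQuadSeries_mul_sqrtSeries : sqrtQuadSeries * sqrtSeries = sqrtCubeSeries := by
  rw [sqrtQuadSeries]
  linear_combination sqrtCubeSeries * sqrtSeries_mul_invSqrtSeries

theorem coeff_sqrtCubeSeries_le_coeff_sqrtQuadSeries {m : ℕ} (hm : m ≠ 0) :
    coeff m sqrtCubeSeries ≤ coeff m sqrtQuadSeries := by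
  obtain ⟨L, r, hr, hr3, rfl⟩ : ∃ L r, 1 ≤ r ∧ r ≤ 3 ∧ m = 3 * L + r :=
    ⟨(m - 1) / 3, (m - 1) % 3 + 1, by omega, by omega, by omega⟩
  have hsum : 0 ≤ ∑ i ∈ Finset.range (3 * L + r),
      coeff i sqrtCubeSeries * invSqrtCoeff (3 * L + r - i) := by
    rw [Finset.sum_range_three_mul_add_of_not_dvd _ _ L hr hr3]
    · refine (sum_coeff_sqrtSeries_mul_invSqrtCoeff_nonneg L hr).trans_eq
        (Finset.sum_congr rfl fun i hi => ?_)
      have hi' := Finset.mem_range.mp hi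
      rw [sqrtCubeSeries, coeff_expand_mul, show 3 * L + r - 3 * i = 3 * (L - i) + r by omega]
    · intro i hi
      rw [sqrtCubeSeries, coeff_expand_of_not_dvd _ _ _ hi, zero_mul]
  rw [sqrtQuadSeries, coeff_mul, Finset.Nat.sum_antidiagonal_eq_sum_range_succ_mk,
    Finset.sum_range_succ]
  simp only [invSqrtSeries, coeff_mk, Nat.sub_self, invSqrtCoeff_zero, mul_one]
  linarith

theorem sum_coeff_sqrtQuadSeries_mul_coeff_sqrtSeries_nonpos {k i : ℕ} (hik : i < k) :
    ∑ j ∈ Finset.range (i + 1), coeff j sqrtQuadSeries * coeff (k - j) sqrtSeries ≤ 0 := by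
  induction k generalizing i with
  | zero => omega
  | succ k ih =>
    rcases Nat.lt_succ_iff_lt_or_eq.mp hik with hik | rfl
    · have step : ∀ i < k,
          ∑ j ∈ Finset.range (i + 1), coeff j sqrtQuadSeries * coeff (k + 1 - j) sqrtSeries ≤
          (2 * ((k - i - 1 : ℕ) : ℝ) + 1) / (2 * ((k - i - 1 : ℕ) : ℝ) + 4) *
          ∑ j ∈ Finset.range (i + 1), coeff j sqrtQuadSeries * coeff (k - j) sqrtSeries := by
        intro i hi
        induction i with
        | zero =>
          obtain ⟨k, rfl⟩ := Nat.exists_eq_succ_of_ne_zero hi.ne'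
          simp [-coeff_zero_eq_constantCoeff, coeff_zero_sqrtQuadSeries,
            coeff_add_two_sqrtSeries]
        | succ i ihi =>
          obtain ⟨l, rfl⟩ := Nat.exists_eq_add_of_lt hi
          have hi' : i < i + 1 + l + 1 := by omega
          have h1 := ihi hi'
          have h2 := ih hi'
          rw [Finset.sum_range_succ, Finset.sum_range_succ _ (i + 1), mul_add,
            show i + 1 + l + 1 + 1 - (i + 1) = l + 2 by omega,
            show i + 1 + l + 1 - (i + 1) = l + 1 by omega, coeff_add_two_sqrtSeries]
          rw [show i + 1 + l + 1 - i - 1 = l + 1 by omega] at h1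
          simp only [Nat.add_sub_cancel]
          have h3 : (2 * (l : ℝ) + 1) / (2 * l + 4) ≤
              (2 * ((l + 1 : ℕ) : ℝ) + 1) / (2 * ((l + 1 : ℕ) : ℝ) + 4) := by
            push_cast
            rw [div_le_div_iff₀ (by positivity) (by positivity)]
            nlinarith
          have h4 := mul_le_mul_of_nonpos_right h3 h2
          linarith
      exact (step i hik).trans (mul_nonpos_of_nonneg_of_nonpos (by positivity) (ih hik))
    · have h := congrArg (coeff (i + 1)) sqrtQuadSeries_mul_sqrtSeries
      rw [coeff_mul, Finset.Nat.sum_antidiagonal_eq_sum_range_succ_mk, Finset.sum_range_succ] at h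
      simp only [Nat.sub_self, coeff_zero_sqrtSeries, mul_one] at h
      have := coeff_sqrtCubeSeries_le_coeff_sqrtQuadSeries (Nat.succ_ne_zero i)
      linarith

theorem PowerSeries.coeff_trunc_mul_of_le (F G : PowerSeries ℝ) {n k : ℕ} (h : n ≤ k) :
    coeff k ((trunc (n + 1) F : PowerSeries ℝ) * G) =
      ∑ j ∈ Finset.range (n + 1), coeff j F * coeff (k - j) G := by
  rw [coeff_mul, Finset.Nat.sum_antidiagonal_eq_sum_range_succ_mk]
  symm
  refine Finset.sum_subset_zero_on_sdiff (Finset.range_mono (by omega)) (fun j hj => ?_)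
    fun j hj => ?_
  · simp only [Finset.mem_sdiff, Finset.mem_range] at hj
    simp [coeff_trunc, hj.2]
  · simp [coeff_trunc, Finset.mem_range.mp hj]

theorem coeff_trunc_sqrtQuadSeries_mul_sqrtSeries_nonpos (n : ℕ) {k : ℕ} (hk : k ≠ 0) :
    coeff k ((trunc (n + 1) sqrtQuadSeries : PowerSeries ℝ) * sqrtSeries) ≤ 0 := by
  rcases lt_or_ge n k with h | h
  · rw [coeff_trunc_mul_of_le _ _ h.le]
    exact sum_coeff_sqrtQuadSeries_mul_coeff_sqrtSeries_nonpos h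
  · refine le_of_eq_of_le ?_ (coeff_sqrtCubeSeries_nonpos hk)
    rw [← sqrtQuadSeries_mul_sqrtSeries, coeff_mul, coeff_mul]
    refine Finset.sum_congr rfl fun p hp => ?_
    have := Finset.HasAntidiagonal.mem_antidiagonal.mp hp
    rw [Polynomial.coeff_coe, coeff_trunc, if_pos (by omega)]

theorem tendsto_sum_coeff_trunc_mul_sqrtSeries (F : PowerSeries ℝ) (n : ℕ) :
    Filter.Tendsto (fun N => ∑ k ∈ Finset.range N,
      coeff k ((trunc (n + 1) F : PowerSeries ℝ) * sqrtSeries)) Filter.atTop (nhds 0) := by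
  set E : PowerSeries ℝ := (trunc (n + 1) F : PowerSeries ℝ) * invSqrtSeries with hE
  have hprod : (trunc (n + 1) F : PowerSeries ℝ) * sqrtSeries = E - X * E := by
    rw [hE, sqrtSeries]
    ring
  have hpartial : ∀ N, ∑ k ∈ Finset.range (N + 1),
      coeff k ((trunc (n + 1) F : PowerSeries ℝ) * sqrtSeries) = coeff N E := by
    intro N
    rw [hprod]
    induction N with
    | zero => simp
    | succ N ih =>
      rw [Finset.sum_range_succ, ih, map_sub, coeff_succ_X_mul]
      ring
  rw [← Filter.tendsto_add_atTop_iff_nat 1]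
  simp only [hpartial]
  have hlim : Filter.Tendsto (fun N => ∑ j ∈ Finset.range (n + 1),
      coeff j F * invSqrtCoeff (N - j)) Filter.atTop (nhds 0) := by
    have := tendsto_finsetSum (Finset.range (n + 1)) fun j _ =>
      (tendsto_invSqrtCoeff.comp (Filter.tendsto_sub_atTop_nat j)).const_mul (coeff j F)
    simpa using this
  refine hlim.congr' ?_
  filter_upwards [Filter.eventually_ge_atTop n] with N hN
  rw [hE, coeff_trunc_mul_of_le _ _ hN]
  simp [invSqrtSeries]

/-- Let `b_k` be the Taylor coefficients of the principal branch of
`√(1+z+z²)`, `T_n(z) = ∑_{k=0}^n b_k z^k`, and let `γ_k` be the Taylor coefficients at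
`0` of `T_n(z)√(1-z)`. Then `γ_0 = 1`, the series `∑ γ_k` converges absolutely with sum
`0`, and `∑_{k=1}^∞ |γ_k| = 1`. -/
theorem product_coeff_sum
    (b : ℕ → ℝ)
    (hb : ∀ᶠ z : ℂ in nhds 0,
      HasSum (fun k : ℕ => (b k : ℂ) * z ^ k) ((1 + z + z ^ 2) ^ ((1 : ℂ) / 2)))
    (n : ℕ) (γ : ℕ → ℝ)
    (hγ : ∀ᶠ z : ℂ in nhds 0,
      HasSum (fun k : ℕ => (γ k : ℂ) * z ^ k)
        ((∑ k ∈ Finset.range (n + 1), (b k : ℂ) * z ^ k) * (1 - z) ^ ((1 : ℂ) / 2))) :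
    γ 0 = 1 ∧ Summable (fun k : ℕ => |γ k|) ∧ HasSum γ 0 ∧
      (∑' k : ℕ, |γ (k + 1)|) = 1 := by
  have cpow_half_sq : ∀ w : ℂ, w ^ ((1 : ℂ) / 2) * w ^ ((1 : ℂ) / 2) = w := fun w => by
    rw [one_div, ← pow_two, Complex.cpow_ofNat_inv_pow]
  have hB : ConvergesNearZero (mk b) fun z => (1 + z + z ^ 2) ^ ((1 : ℂ) / 2) := by
    simpa [ConvergesNearZero] using hb
  have hB_eq : mk b = sqrtQuadSeries := by
    refine eq_of_sq_eq_sq_of_coeff_zero ?_ ?_ coeff_zero_sqrtQuadSeries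
    · rw [sqrtQuadSeries_sq, pow_two]
      refine ((hB.mul hB).congr fun z => cpow_half_sq _).unique ?_
      have h := ConvergesNearZero.polynomial (1 + Polynomial.X + Polynomial.X ^ 2)
      push_cast at h
      exact h.congr fun z => by simp
    · have h := hB.coeff_zero
      simp only [ne_eq, OfNat.ofNat_ne_zero, not_false_eq_true, zero_pow, add_zero,
        Complex.one_cpow] at h
      exact_mod_cast h
  have hb_coeff : ∀ k, b k = coeff k sqrtQuadSeries := fun k => by rw [← hB_eq, coeff_mk]
  set T := trunc (n + 1) sqrtQuadSeries with hT
  have hT_conv : ConvergesNearZero (T : PowerSeries ℝ)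
      fun z => ∑ k ∈ Finset.range (n + 1), (b k : ℂ) * z ^ k := by
    refine (ConvergesNearZero.polynomial T).congr fun z => ?_
    rw [Polynomial.aeval_eq_sum_range' (natDegree_trunc_lt _ n)]
    refine Finset.sum_congr rfl fun k hk => ?_
    rw [coeff_trunc, if_pos (Finset.mem_range.mp hk), hb_coeff, Complex.real_smul]
  have hΓ : ConvergesNearZero (mk γ) fun z =>
      (∑ k ∈ Finset.range (n + 1), (b k : ℂ) * z ^ k) * (1 - z) ^ ((1 : ℂ) / 2) := by
    simpa [ConvergesNearZero] using hγ
  have hb0 : b 0 = 1 := by rw [hb_coeff, coeff_zero_sqrtQuadSeries]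
  have hγ0 : γ 0 = 1 := by
    have h := hΓ.coeff_zero
    rw [Finset.sum_range_succ'] at h
    simp [hb0, -coeff_zero_eq_constantCoeff] at h
    exact_mod_cast h
  have hΓ_eq : mk γ = (T : PowerSeries ℝ) * sqrtSeries := by
    refine eq_of_sq_eq_sq_of_coeff_zero ?_ (by rw [coeff_mk, hγ0]) ?_
    · rw [mul_pow, sqrtSeries_sq, pow_two, pow_two]
      refine (hΓ.mul hΓ).unique ?_
      have h := ConvergesNearZero.polynomial (1 - Polynomial.X)
      push_cast at h
      refine ((hT_conv.mul hT_conv).mul h).congr fun z => ?_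
      rw [mul_mul_mul_comm, cpow_half_sq]
      simp
    · rw [coeff_mul, Finset.HasAntidiagonal.antidiagonal_zero, Finset.sum_singleton,
         coeff_zero_sqrtSeries, hT, Polynomial.coeff_coe, coeff_trunc,
        if_pos n.succ_pos, coeff_zero_sqrtQuadSeries, one_mul]
  have hγ_coeff : ∀ k, γ k = coeff k ((T : PowerSeries ℝ) * sqrtSeries) := fun k => by
    rw [← hΓ_eq, coeff_mk]
  have hγ_abs : ∀ k, |γ (k + 1)| = -γ (k + 1) := fun k => by
    rw [hγ_coeff]
    exact abs_of_nonpos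
      (coeff_trunc_sqrtQuadSeries_mul_sqrtSeries_nonpos n (Nat.succ_ne_zero k))
  have hlim : Filter.Tendsto (fun N => ∑ k ∈ Finset.range N, γ k) Filter.atTop (nhds 0) := by
    simpa only [hγ_coeff] using tendsto_sum_coeff_trunc_mul_sqrtSeries sqrtQuadSeries n
  have habs_sum : HasSum (fun k => |γ (k + 1)|) 1 := by
    rw [hasSum_iff_tendsto_nat_of_nonneg fun k => abs_nonneg _]
    have h := ((Filter.tendsto_add_atTop_iff_nat 1).mpr hlim).const_sub 1
    rw [sub_zero] at h
    refine h.congr fun N => ?_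
    simp only [Finset.sum_range_succ', hγ0, hγ_abs, Finset.sum_neg_distrib]
    ring
  have hsummable : Summable fun k => |γ k| := (summable_nat_add_iff 1).mp habs_sum.summable
  exact ⟨hγ0, hsummable, hsummable.of_abs.hasSum_iff_tendsto_nat.mpr hlim, habs_sum.tsum_eq⟩
end
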